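/- Let A be a σ-finite AW*-algebra and let I be a closed right ideal of A. Then there exists a ∈ I such that the closed right ideal J given by the norm closure of aA = {ax : x ∈ A} satisfies J ⊆ I and ℓ_A(J) = ℓ_A(I). -/

import Mathlib

variable {A : Type*} [CStarAlgebra A]

/-- A submodule `J ⊆ A` is a right ideal if it is closed under right multiplication
by arbitrary elements of `A`. -/
def IsRightIdeal (J : Submodule ℂ A) : Prop :=
  ∀ x ∈ J, ∀ a : A, x * a ∈ J

/-- A unital C*-algebra is an AW*-algebra if the right annihilator of every subset is
generated, as a right ideal, by a projection. -/
def IsAWStar (A : Type*) [CStarAlgebra A] : Prop :=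
  ∀ S : Set A, ∃ p : A, star p = p ∧ p * p = p ∧
    ∀ a : A, (∀ s ∈ S, s * a = 0) ↔ ∃ b : A, a = p * b

/-- An algebra is σ-finite if every family of pairwise orthogonal nonzero projections
is countable. -/
def SigmaFiniteAlg (A : Type*) [CStarAlgebra A] : Prop :=
  ∀ P : Set A, (∀ p ∈ P, star p = p ∧ p * p = p ∧ p ≠ 0) →
    (∀ p ∈ P, ∀ q ∈ P, p ≠ q → p * q = 0) → P.Countable

/-- In an AW*-algebra, left annihilators are generated, as left ideals, by projections. -/
theorem IsAWStar.exists_leftAnnihilator (hAW : IsAWStar A) (S : Set A) :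
    ∃ p : A, star p = p ∧ p * p = p ∧ ∀ a : A, (∀ s ∈ S, a * s = 0) ↔ a * p = a := by
  obtain ⟨p, hp, hpp, h⟩ := hAW (star '' S)
  refine ⟨p, hp, hpp, fun a => ?_⟩
  have h₁ : (∀ s ∈ S, a * s = 0) ↔ ∀ s ∈ star '' S, s * star a = 0 := by
    rw [Set.forall_mem_image]
    refine forall₂_congr fun s _ => ?_
    rw [← star_mul, star_eq_zero]
  rw [h₁, h]
  constructor
  · rintro ⟨b, hb⟩
    rw [← star_star a, hb, star_mul, hp, mul_assoc, hpp]
  · intro ha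
    exact ⟨star a, by rw [← hp, ← star_mul, ha]⟩

/-- In a σ-finite AW*-algebra, every set has a countable subset with the same left annihilator. -/
theorem IsAWStar.exists_countable_leftAnnihilator_eq (hAW : IsAWStar A) (hsf : SigmaFiniteAlg A)
    (I : Set A) :
    ∃ S ⊆ I, S.Countable ∧ ∀ b : A, (∀ s ∈ S, b * s = 0) → ∀ y ∈ I, b * y = 0 := by
  obtain ⟨M, hM⟩ := zorn_subset
    {P : Set A | (∀ p ∈ P, (star p = p ∧ p * p = p ∧ p ≠ 0) ∧
      ∃ S ⊆ I, S.Countable ∧ ∀ b : A, (∀ s ∈ S, b * s = 0) → b * p = 0) ∧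
      ∀ p ∈ P, ∀ q ∈ P, p ≠ q → p * q = 0} (by
    intro c hc hchain
    refine ⟨⋃₀ c, ⟨?_, ?_⟩, fun s hs => Set.subset_sUnion_of_mem hs⟩
    · rintro p ⟨P, hP, hp⟩
      exact (hc hP).1 p hp
    · rintro p ⟨P, hP, hp⟩ q ⟨Q, hQ, hq⟩ hpq
      rcases hchain.total hP hQ with h | h
      · exact (hc hQ).2 p (h hp) q hq hpq
      · exact (hc hP).2 p hp q (h hq) hpq)
  obtain ⟨hM₁, hM₂⟩ := hM.prop
  have hMc : M.Countable := hsf M (fun p hp => (hM₁ p hp).1) hM₂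
  choose! T hTI hTc hT using fun p hp => (hM₁ p hp).2
  set S : Set A := ⋃ p ∈ M, T p with hS
  have hSI : S ⊆ I := Set.iUnion₂_subset hTI
  have hSc : S.Countable := hMc.biUnion hTc
  have hSM : ∀ b : A, (∀ s ∈ S, b * s = 0) → ∀ q ∈ M, b * q = 0 := fun b hb q hq =>
    hT q hq b fun s hs => hb s (Set.mem_biUnion hq hs)
  refine ⟨S, hSI, hSc, fun b hb x hx => ?_⟩
  by_contra hbx
  obtain ⟨e, he, hee, hSe⟩ := hAW.exists_leftAnnihilator S
  obtain ⟨f, hf, hff, hSf⟩ := hAW.exists_leftAnnihilator (insert x S)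
  have hf0 := (hSf f).2 hff
  have he0 := (hSe e).2 hee
  have hfS : ∀ s ∈ S, f * s = 0 := fun s hs => hf0 s (Set.mem_insert_of_mem x hs)
  have hfe : f * e = f := (hSe f).1 hfS
  have hef : e * f = f := by rw [← he, ← hf, ← star_mul, hfe]
  have hpS : ∀ s ∈ S, (e - f) * s = 0 := fun s hs => by
    rw [sub_mul, he0 s hs, hfS s hs, sub_zero]
  have hps : star (e - f) = e - f := by rw [star_sub, he, hf]
  have hpp : (e - f) * (e - f) = e - f := by
    rw [mul_sub, sub_mul, sub_mul, hee, hff, hfe, hef, sub_self, sub_zero]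
  have hp0 : e - f ≠ 0 := by
    intro h
    apply hbx
    rw [← (hSe b).1 hb, mul_assoc, sub_eq_zero.1 h, hf0 x (Set.mem_insert x S), mul_zero]
  have hpM : ∀ q ∈ M, (e - f) * q = 0 := hSM _ hpS
  have hMp : ∀ q ∈ M, q * (e - f) = 0 := fun q hq => by
    rw [← (hM₁ q hq).1.1, ← hps, ← star_mul, hpM q hq, star_zero]
  have hmem : e - f ∈ M := by
    refine hM.le_of_ge (y := insert (e - f) M) ⟨?_, ?_⟩ (Set.subset_insert _ _)
      (Set.mem_insert _ _)
    · rintro q (rfl | hq)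
      · refine ⟨⟨hps, hpp, hp0⟩, insert x S, Set.insert_subset hx hSI, hSc.insert x, ?_⟩
        intro c hc
        rw [← (hSf c).1 hc, mul_assoc, mul_sub, hfe, hff, sub_self, mul_zero]
      · exact hM₁ q hq
    · rintro p (rfl | hp) q (rfl | hq) hpq
      · exact absurd rfl hpq
      · exact hpM q hq
      · exact hMp p hp
      · exact hM₂ p hp q hq hpq
  exact hp0 (hpp.symm.trans (hpM _ hmem))

/-- If `∑ gₙ gₙ*` converges to `a`, then every `b` with `b a = 0` annihilates all `gₙ`. -/
theorem mul_eq_zero_of_hasSum_mul_star {g : ℕ → A} {a b : A}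
    (hg : HasSum (fun n => g n * star (g n)) a) (hb : b * a = 0) (n : ℕ) : b * g n = 0 := by
  let _ := CStarAlgebra.spectralOrder A
  have _ := CStarAlgebra.spectralOrderedRing A
  have h := (hg.mul_left b).mul_right (star b)
  rw [hb, zero_mul] at h
  have hrw : (fun n => b * (g n * star (g n)) * star b) =
      fun n => (b * g n) * star (b * g n) := by
    funext n
    simp only [star_mul, mul_assoc]
  rw [hrw] at h
  have hnn : ∀ n, 0 ≤ (b * g n) * star (b * g n) := fun n => mul_star_self_nonneg _
  have hle := le_hasSum h n fun m _ => hnn m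
  exact CStarRing.mul_star_self_eq_zero_iff _ |>.1 (le_antisymm hle (hnn n))

/-- For a countable subset `S` of a closed right ideal `I`, some single element of `I` has left
annihilator contained in that of `S`. -/
theorem exists_mem_leftAnnihilator_le (I : Submodule ℂ A) (hIr : IsRightIdeal I)
    (hIc : IsClosed (I : Set A)) {S : Set A} (hSI : S ⊆ I) (hS : S.Countable) :
    ∃ a ∈ I, ∀ b : A, b * a = 0 → ∀ s ∈ S, b * s = 0 := by
  rcases S.eq_empty_or_nonempty with rfl | hne
  · exact ⟨0, I.zero_mem, by simp⟩
  obtain ⟨x, rfl⟩ := hS.exists_eq_range hne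
  set r : ℕ → ℝ := fun n => (1 / 2) ^ n / (1 + ‖x n‖) with hr
  have hr0 : ∀ n, 0 < r n := fun n => by positivity
  set g : ℕ → A := fun n => (r n : ℂ) • x n with hg
  have hgn : ∀ n, ‖g n‖ ≤ (1 / 2) ^ n := fun n => by
    rw [hg, norm_smul, Complex.norm_real, Real.norm_of_nonneg (hr0 n).le, hr, div_mul_eq_mul_div,
      div_le_iff₀ (by positivity)]
    gcongr
    linarith
  have hsum : Summable fun n => g n * star (g n) := by
    refine .of_norm_bounded (g := fun n => ((1 / 4 : ℝ)) ^ n)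
      (summable_geometric_of_lt_one (by norm_num) (by norm_num)) fun n => ?_
    rw [CStarRing.norm_self_mul_star]
    calc ‖g n‖ * ‖g n‖ ≤ (1 / 2) ^ n * (1 / 2) ^ n := by gcongr <;> exact hgn n
      _ = (1 / 4) ^ n := by rw [← mul_pow]; norm_num
  have hgI : ∀ n, g n * star (g n) ∈ I := fun n =>
    hIr _ (I.smul_mem _ (hSI ⟨n, rfl⟩)) _
  refine ⟨∑' n, g n * star (g n), ?_, ?_⟩
  · exact hIc.mem_of_tendsto hsum.hasSum (Filter.Eventually.of_forall fun s =>
      I.sum_mem fun n _ => hgI n)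
  · rintro b hb _ ⟨n, rfl⟩
    have h := mul_eq_zero_of_hasSum_mul_star hsum.hasSum hb n
    rw [hg, mul_smul_comm, smul_eq_zero] at h
    exact h.resolve_left (Complex.ofReal_ne_zero.2 (hr0 n).ne')

theorem stmt7 (hAW : IsAWStar A) (hsf : SigmaFiniteAlg A)
    (I : Submodule ℂ A) (hIr : IsRightIdeal I) (hIc : IsClosed (I : Set A)) :
    ∃ a ∈ I, closure {y : A | ∃ x : A, y = a * x} ⊆ (I : Set A) ∧
      {b : A | ∀ y ∈ closure {y : A | ∃ x : A, y = a * x}, b * y = 0} =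
        {b : A | ∀ y ∈ (I : Set A), b * y = 0} := by
  obtain ⟨S, hSI, hSc, hS⟩ := hAW.exists_countable_leftAnnihilator_eq hsf (I : Set A)
  obtain ⟨a, haI, ha⟩ := exists_mem_leftAnnihilator_le I hIr hIc hSI hSc
  have hsub : closure {y : A | ∃ x : A, y = a * x} ⊆ (I : Set A) := by
    refine closure_minimal ?_ hIc
    rintro _ ⟨x, rfl⟩
    exact hIr a haI x
  refine ⟨a, haI, hsub, Set.Subset.antisymm (fun b hb => ?_) fun b hb y hy => hb y (hsub hy)⟩
  exact hS b (ha b (hb a (subset_closure ⟨1, (mul_one a).symm⟩)))
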